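/- Let z be an irrational real number whose continued fraction partial quotients a_n are bounded, i.e. there is K ∈ ℕ with a_n ≤ K for all n ≥ 1, and let x_n := {n z} be the Kronecker sequence of z. Then z generates a low-discrepancy sequence: there exists a constant C > 0 (depending only on K) such that D_N*(x₁,…,x_N) ≤ C · log(N+1) / N for all N ≥ 1. -/

import Mathlib

open scoped Classical

/-- Iterated fractional parts of the continued fraction (Gauss map) algorithm:
`cfX z 0 = {z}`, `cfX z (n+1) = {1 / cfX z n}`. -/
noncomputable def cfX (z : ℝ) : ℕ → ℝ
  | 0 => Int.fract z
  | n + 1 => Int.fract (1 / cfX z n)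

/-- Partial quotients of the continued fraction expansion `z = [a₀; a₁, a₂, …]`:
`cfA z n = aₙ` for `n ≥ 1` (the value at `0` is a dummy). -/
noncomputable def cfA (z : ℝ) : ℕ → ℕ
  | 0 => 0
  | n + 1 => ⌊1 / cfX z n⌋₊

/-- Star-discrepancy of the first `N` points of a sequence in `[0,1)`. -/
noncomputable def starDiscrepancy (N : ℕ) (x : ℕ → ℝ) : ℝ :=
  sSup {v : ℝ | ∃ b : ℝ, 0 < b ∧ b ≤ 1 ∧
    v = |(((Finset.Icc 1 N).filter (fun n => 0 ≤ x n ∧ x n < b)).card : ℝ) / N - b|}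


lemma block_aux (z b : ℝ) (hb0 : 0 < b) (hb1 : b ≤ 1) (p : ℤ) (q : ℕ) (hq : 1 ≤ q)
    (hco : IsCoprime p (q : ℤ)) (happ : |(q : ℝ) * z - p| * q ≤ 1) (m : ℕ) :
    |(((Finset.Ioc m (m + q)).filter (fun n : ℕ => Int.fract ((n : ℝ) * z) < b)).card : ℝ)
      - q * b| ≤ 4 := by
  have hq0 : (0 : ℝ) < q := by exact_mod_cast hq
  have hqz : (0 : ℤ) < q := by exact_mod_cast hq
  set s : ℤ := ⌊(q : ℝ) * (m * z)⌋ with hs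
  let f : ℕ → ℤ := fun n => (s + ((n : ℤ) - m) * p) % q
  have hf0 : ∀ n, 0 ≤ f n := fun n => Int.emod_nonneg _ hqz.ne'
  have hf1 : ∀ n, f n < q := fun n => Int.emod_lt_of_pos _ hqz
  have hinj : Set.InjOn f (Finset.Ioc m (m + q) : Finset ℕ) := by
    intro i hi j hj hij
    simp only [Finset.coe_Ioc, Set.mem_Ioc] at hi hj
    have h1 : (q : ℤ) ∣ (s + ((i : ℤ) - m) * p) - (s + ((j : ℤ) - m) * p) :=
      Int.ModEq.dvd (Int.ModEq.symm hij)
    have h2 : (q : ℤ) ∣ p * ((i : ℤ) - j) := by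
      convert h1 using 1; ring
    have h3 : (q : ℤ) ∣ (i : ℤ) - j := hco.symm.dvd_of_dvd_mul_left h2
    have h4 : (i : ℤ) - j = 0 := by
      apply Int.eq_zero_of_abs_lt_dvd h3
      rw [abs_lt]; constructor <;> omega
    omega
  -- key: interior residues determine the fractional part up to 2/q
  have key : ∀ n ∈ Finset.Ioc m (m + q), 1 ≤ f n → f n ≤ q - 2 →
      ∃ t : ℝ, -1 ≤ t ∧ t < 2 ∧ Int.fract ((n : ℝ) * z) * q = f n + t := by
    intro n hn h1 h2
    simp only [Finset.mem_Ioc] at hn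
    set t : ℝ := (q * (m * z) - s) + ((n : ℝ) - m) * (q * z - p) with ht
    have ha : 0 ≤ (q : ℝ) * (m * z) - s := by
      have := Int.floor_le ((q : ℝ) * (m * z)); rw [hs]; linarith
    have ha' : (q : ℝ) * (m * z) - s < 1 := by
      have := Int.lt_floor_add_one ((q : ℝ) * (m * z)); rw [hs]; linarith
    have hnm : (m : ℝ) < n := by exact_mod_cast hn.1
    have hnm' : (n : ℝ) ≤ m + q := by exact_mod_cast hn.2
    have hb : |((n : ℝ) - m) * (q * z - p)| ≤ 1 := by
      rw [abs_mul, abs_of_pos (by linarith : (0 : ℝ) < n - m)]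
      have := abs_nonneg ((q : ℝ) * z - p)
      nlinarith
    rw [abs_le] at hb
    refine ⟨t, by linarith, by linarith, ?_⟩
    have hdiv : (q : ℤ) * ((s + ((n : ℤ) - m) * p) / q) + f n = s + ((n : ℤ) - m) * p :=
      Int.mul_ediv_add_emod _ _
    set d : ℤ := (s + ((n : ℤ) - m) * p) / q with hd
    have hdivR : (q : ℝ) * d + f n = s + ((n : ℝ) - m) * p := by exact_mod_cast hdiv
    have hnz : ((n : ℝ) * z) * q = q * d + f n + t := by
      rw [hdivR, ht]; ring
    have h1R : (1 : ℝ) ≤ f n := by exact_mod_cast h1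
    have h2R : (f n : ℝ) ≤ q - 2 := by exact_mod_cast h2
    have hfr : Int.fract ((n : ℝ) * z) = (f n + t) / q := by
      rw [Int.fract_eq_iff]
      refine ⟨by apply div_nonneg <;> linarith, by rw [div_lt_one hq0]; linarith, d, ?_⟩
      field_simp
      linarith
    rw [hfr]; field_simp
  set A := (Finset.Ioc m (m + q)).filter (fun n : ℕ => Int.fract ((n : ℝ) * z) < b) with hA
  set B := (Finset.Ioc m (m + q)).filter (fun n : ℕ => ¬ Int.fract ((n : ℝ) * z) < b) with hB
  have hAB : A.card + B.card = q := by
    rw [hA, hB, Finset.card_filter_add_card_filter_not]; simp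
  have hqb : 0 < (q : ℝ) * b := by positivity
  have hqb1 : (q : ℝ) * b ≤ q := by nlinarith
  have pair : ∀ a c : ℤ, (({a, c} : Finset ℤ).card : ℝ) ≤ 2 := by
    intro a c; exact_mod_cast Finset.card_le_two
  have hAc : (A.card : ℝ) ≤ q * b + 4 := by
    have h1 : A.card ≤ (({0, (q : ℤ) - 1} : Finset ℤ) ∪ Finset.Ico 0 ⌈(q : ℝ) * b + 1⌉).card := by
      apply Finset.card_le_card_of_injOn f
      · intro n hn
        have hn' : n ∈ A := hn
        rw [hA, Finset.mem_filter] at hn'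
        simp only [Finset.coe_union, Finset.coe_insert, Finset.coe_singleton, Finset.coe_Ico,
          Set.mem_union, Set.mem_insert_iff, Set.mem_singleton_iff, Set.mem_Ico]
        by_cases h : 1 ≤ f n ∧ f n ≤ q - 2
        · right
          obtain ⟨t, ht1, ht2, ht3⟩ := key n hn'.1 h.1 h.2
          refine ⟨hf0 n, ?_⟩
          rw [Int.lt_ceil]
          have := mul_lt_mul_of_pos_right hn'.2 hq0
          linarith
        · left
          have := hf0 n; have := hf1 n
          omega
      · exact hinj.mono (by rw [hA]; intro x hx; exact (Finset.mem_filter.1 hx).1)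
    have h2 := h1.trans (Finset.card_union_le _ _)
    have h3 : ((Finset.Ico 0 ⌈(q : ℝ) * b + 1⌉).card : ℝ) = ⌈(q : ℝ) * b + 1⌉ := by
      have h0 : 0 ≤ ⌈(q : ℝ) * b + 1⌉ := Int.ceil_nonneg (by linarith)
      rw [Int.card_Ico, sub_zero]
      exact_mod_cast Int.toNat_of_nonneg h0
    have h4 := Int.ceil_lt_add_one ((q : ℝ) * b + 1)
    have h5 : (A.card : ℝ) ≤ (({0, (q : ℤ) - 1} : Finset ℤ).card : ℝ)
      + ((Finset.Ico 0 ⌈(q : ℝ) * b + 1⌉).card : ℝ) := by exact_mod_cast h2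
    have := pair 0 ((q : ℤ) - 1)
    linarith
  have hBc : (B.card : ℝ) ≤ q - q * b + 4 := by
    have h1 : B.card ≤ (({0, (q : ℤ) - 1} : Finset ℤ) ∪
        Finset.Ioc ⌊(q : ℝ) * b - 2⌋ ((q : ℤ) - 1)).card := by
      apply Finset.card_le_card_of_injOn f
      · intro n hn
        have hn' : n ∈ B := hn
        rw [hB, Finset.mem_filter] at hn'
        simp only [Finset.coe_union, Finset.coe_insert, Finset.coe_singleton, Finset.coe_Ioc,
          Set.mem_union, Set.mem_insert_iff, Set.mem_singleton_iff, Set.mem_Ioc]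
        by_cases h : 1 ≤ f n ∧ f n ≤ q - 2
        · right
          obtain ⟨t, ht1, ht2, ht3⟩ := key n hn'.1 h.1 h.2
          refine ⟨?_, by have := hf1 n; omega⟩
          rw [Int.floor_lt]
          have := mul_le_mul_of_nonneg_right (not_lt.1 hn'.2) hq0.le
          linarith
        · left
          have := hf0 n; have := hf1 n
          omega
      · exact hinj.mono (by rw [hB]; intro x hx; exact (Finset.mem_filter.1 hx).1)
    have h2 := h1.trans (Finset.card_union_le _ _)
    have h3 : ((Finset.Ioc ⌊(q : ℝ) * b - 2⌋ ((q : ℤ) - 1)).card : ℝ)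
        = (q : ℝ) - 1 - ⌊(q : ℝ) * b - 2⌋ := by
      have h0 : ⌊(q : ℝ) * b - 2⌋ < (q : ℤ) := by
        rw [Int.floor_lt]; push_cast; linarith
      rw [Int.card_Ioc]
      have := Int.toNat_of_nonneg (by omega : 0 ≤ (q : ℤ) - 1 - ⌊(q : ℝ) * b - 2⌋)
      exact_mod_cast this
    have h4 := Int.lt_floor_add_one ((q : ℝ) * b - 2)
    have h5 : (B.card : ℝ) ≤ (({0, (q : ℤ) - 1} : Finset ℤ).card : ℝ)
      + ((Finset.Ioc ⌊(q : ℝ) * b - 2⌋ ((q : ℤ) - 1)).card : ℝ) := by exact_mod_cast h2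
    have := pair 0 ((q : ℤ) - 1)
    linarith
  have hABR : (A.card : ℝ) + B.card = q := by exact_mod_cast hAB
  rw [abs_le]; constructor <;> linarith

lemma cfX_irr (z : ℝ) (hz : Irrational z) (n : ℕ) : Irrational (cfX z n) := by
  have hfr : ∀ y : ℝ, Irrational y → Irrational (Int.fract y) := by
    intro y hy
    exact hy.sub_intCast _
  induction n with
  | zero => exact hfr z hz
  | succ n ih =>
    rw [cfX]
    apply hfr
    rw [one_div]
    exact ih.inv

lemma cfX_mem (z : ℝ) (hz : Irrational z) (n : ℕ) : 0 < cfX z n ∧ cfX z n < 1 := by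
  have h0 : 0 ≤ cfX z n ∧ cfX z n < 1 := by
    cases n <;> exact ⟨Int.fract_nonneg _, Int.fract_lt_one _⟩
  exact ⟨lt_of_le_of_ne h0.1 (cfX_irr z hz n).ne_zero.symm, h0.2⟩

lemma approx_aux (z x : ℝ) (p p' : ℤ) (q q' : ℕ) (hx0 : 0 < x) (hx1 : x < 1) (hq : 1 ≤ q)
    (hdet : |p * q' - p' * q| = 1) (hrel : (q : ℝ) * z - p = - x * (q' * z - p')) :
    IsCoprime p (q : ℤ) ∧ |(q : ℝ) * z - p| * q ≤ 1 := by
  have hq0 : (1 : ℝ) ≤ q := by exact_mod_cast hq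
  have hq'0 : (0 : ℝ) ≤ q' := by positivity
  constructor
  · rcases (abs_eq (by norm_num : (0 : ℤ) ≤ 1)).1 hdet with h | h
    · exact ⟨q', -p', by linarith⟩
    · exact ⟨-q', p', by linarith⟩
  · have hd : |(p : ℝ) * q' - p' * q| = 1 := by exact_mod_cast hdet
    have h1 : ((q : ℝ) * z - p) * (q + q' * x) = - x * (p * q' - p' * q) := by
      linear_combination (q : ℝ) * hrel 
    have h2 : |(q : ℝ) * z - p| * (q + q' * x) = x := by
      have := congrArg abs h1
      rw [abs_mul, abs_mul, hd, abs_neg, abs_of_pos hx0,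
        abs_of_pos (by positivity : (0 : ℝ) < q + q' * x)] at this
      linarith
    have := abs_nonneg ((q : ℝ) * z - p)
    have : 0 ≤ |(q : ℝ) * z - p| * (q' * x) := by positivity
    nlinarith

lemma good_q (K : ℕ) (z : ℝ) (hz : Irrational z) (hK : ∀ n : ℕ, 1 ≤ n → cfA z n ≤ K)
    (M : ℕ) (hM : 1 ≤ M) :
    ∃ (p : ℤ) (q : ℕ), 1 ≤ q ∧ q ≤ M ∧ M ≤ (K + 1) * q ∧ IsCoprime p (q : ℤ) ∧
      |(q : ℝ) * z - p| * q ≤ 1 := by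
  by_contra hno
  have main : ∀ n : ℕ, ∃ (p p' : ℤ) (q q' : ℕ), 1 ≤ q ∧ q ≤ M ∧ q' ≤ q ∧ n ≤ q ∧
      (n = 0 ∨ 1 ≤ q') ∧ |p * q' - p' * q| = 1 ∧
      (q : ℝ) * z - p = - (cfX z n) * (q' * z - p') := by
    intro n
    induction n with
    | zero =>
      refine ⟨⌊z⌋, 1, 1, 0, le_rfl, hM, by omega, by omega, Or.inl rfl, by simp, ?_⟩
      simp [cfX]
    | succ n ih =>
      obtain ⟨p, p', q, q', hq, hqM, hq', hnq, hn, hdet, hrel⟩ := ih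
      obtain ⟨hx0, hx1⟩ := cfX_mem z hz n
      have hinv : 1 < 1 / cfX z n := by rw [lt_div_iff₀ hx0]; linarith
      have ha1 : 1 ≤ cfA z (n + 1) := by
        rw [cfA]; exact Nat.le_floor (by simpa using hinv.le)
      have haK := hK (n + 1) (by omega)
      have hxs : cfX z (n + 1) = 1 / cfX z n - cfA z (n + 1) := by
        rw [cfX, cfA, Int.fract, natCast_floor_eq_intCast_floor (by linarith)]
      set a := cfA z (n + 1) with ha
      have hle : a * q + q' ≤ M := by
        by_contra hlt
        have h := approx_aux z (cfX z n) p p' q q' hx0 hx1 hq hdet hrel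
        exact hno ⟨p, q, hq, hqM, by nlinarith, h.1, h.2⟩
      refine ⟨a * p + p', p, a * q + q', q, by nlinarith, hle, by nlinarith, ?_, Or.inr hq, ?_, ?_⟩
      · rcases hn with h | h
        · subst h; nlinarith
        · nlinarith
      · rw [← hdet, ← abs_neg]; congr 1; push_cast; ring
      · rw [hxs]; push_cast
        have : (1 / cfX z n) * ((q : ℝ) * z - p) = - (q' * z - p') := by
          rw [hrel]; field_simp
        linear_combination this
  obtain ⟨p, p', q, q', hq, hqM, hq', hnq, _⟩ := main (M + 1)
  omega

lemma count_bound (K : ℕ) (z : ℝ) (hz : Irrational z) (hK : ∀ n : ℕ, 1 ≤ n → cfA z n ≤ K)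
    (b : ℝ) (hb0 : 0 < b) (hb1 : b ≤ 1) (N : ℕ) : ∀ m : ℕ,
    |(((Finset.Ioc m (m + N)).filter (fun n : ℕ => Int.fract ((n : ℝ) * z) < b)).card : ℝ)
      - N * b| ≤ 8 * (K + 1) * Real.log (N + 1) := by
  induction N using Nat.strong_induction_on with
  | _ N ih =>
    intro m
    rcases Nat.eq_zero_or_pos N with h0 | hN
    · subst h0; simp
    obtain ⟨p, q, hq, hqN, hNq, hco, happ⟩ := good_q K z hz hK N hN
    have hblock := block_aux z b hb0 hb1 p q hq hco happ m
    have hrest := ih (N - q) (by omega) (m + q)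
    have hmN : m + q + (N - q) = m + N := by omega
    rw [hmN] at hrest
    have hcard : ((Finset.Ioc m (m + N)).filter (fun n : ℕ => Int.fract ((n : ℝ) * z) < b)).card
        = ((Finset.Ioc m (m + q)).filter (fun n : ℕ => Int.fract ((n : ℝ) * z) < b)).card
        + ((Finset.Ioc (m + q) (m + N)).filter
            (fun n : ℕ => Int.fract ((n : ℝ) * z) < b)).card := by
      rw [← Finset.Ioc_union_Ioc_eq_Ioc (by omega : m ≤ m + q) (by omega : m + q ≤ m + N),
        Finset.filter_union, Finset.card_union_of_disjoint]
      apply Finset.disjoint_filter_filter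
      rw [Finset.disjoint_left]
      intro x hx hx'
      rw [Finset.mem_Ioc] at hx hx'
      omega
    rw [hcard]
    push_cast [hqN] at hrest ⊢
    have hq1 : (1 : ℝ) ≤ q := by exact_mod_cast hq
    have hqNR : (q : ℝ) ≤ N := by exact_mod_cast hqN
    have hNqR : (N : ℝ) ≤ (K + 1) * q := by exact_mod_cast hNq
    have hKp : (0 : ℝ) < K + 1 := by positivity
    have hlog : (q : ℝ) / (N + 1) ≤ Real.log (N + 1) - Real.log (N - q + 1) := by
      have h := Real.log_le_sub_one_of_pos
        (show (0 : ℝ) < (N - q + 1) / (N + 1) by apply div_pos <;> linarith)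
      rw [Real.log_div (by linarith) (by linarith)] at h
      have : ((N : ℝ) - q + 1) / (N + 1) - 1 = - (q / (N + 1)) := by
        field_simp; ring
      linarith
    have h4 : 4 ≤ 8 * ((K : ℝ) + 1) * (q / (N + 1)) := by
      rw [← mul_div_assoc, le_div_iff₀ (by linarith)]
      nlinarith
    have h5 := mul_le_mul_of_nonneg_left hlog (by positivity : (0 : ℝ) ≤ 8 * ((K : ℝ) + 1))
    rw [abs_le] at *
    constructor <;> linarith [hblock.1, hblock.2, hrest.1, hrest.2]

theorem stmt11 (K : ℕ) :
    ∃ C : ℝ, 0 < C ∧ ∀ z : ℝ, Irrational z → (∀ n : ℕ, 1 ≤ n → cfA z n ≤ K) →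
      ∀ N : ℕ, 1 ≤ N →
        starDiscrepancy N (fun n => Int.fract ((n : ℝ) * z)) ≤
          C * Real.log (N + 1) / N := by
  refine ⟨8 * (K + 1), by positivity, ?_⟩
  intro z hz hK N hN
  have hN0 : (0 : ℝ) < N := by exact_mod_cast hN
  apply csSup_le
  · exact ⟨_, 1, one_pos, le_rfl, rfl⟩
  rintro v ⟨b, hb0, hb1, rfl⟩
  have h := count_bound K z hz hK b hb0 hb1 N 0
  have hset : (Finset.Icc 1 N).filter
      (fun n : ℕ => 0 ≤ Int.fract ((n : ℝ) * z) ∧ Int.fract ((n : ℝ) * z) < b)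
      = (Finset.Ioc 0 (0 + N)).filter (fun n : ℕ => Int.fract ((n : ℝ) * z) < b) := by
    ext n
    simp only [Finset.mem_filter, Finset.mem_Icc, Finset.mem_Ioc, Int.fract_nonneg, true_and,
      zero_add]
    rfl
  simp only [hset]
  set c : ℝ := (((Finset.Ioc 0 (0 + N)).filter
    (fun n : ℕ => Int.fract ((n : ℝ) * z) < b)).card : ℝ)
  have : c / N - b = (c - N * b) / N := by field_simp
  rw [this, abs_div, abs_of_pos hN0]
  gcongr
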